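/- arXiv:2001.08315 — 2 statements merged into one kernel-verified Lean document; each statement's English description precedes it below -/
import Mathlib

section
/- Let N ≥ 3 be prime and γ ≥ 0. There exists g₀ (depending on N and γ) such that for every g ≥ g₀ with (N−1)/2 dividing g − γ and (2(g−γ)/(N−1)) mod N ≠ N−1, the weight of S_N satisfies 6(N−1)·W_{S_N} = 2(2N−1)(g−γ)² + (N−1)(N−2)(g−γ) + 6N(N−1)γ² − 3(N−1)g(g+1). -/
/-- A numerical semigroup: a subset of ℕ containing 0, closed under addition,
with finite complement. -/
def IsNumericalSemigroup (S : Set ℕ) : Prop :=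
  0 ∈ S ∧ (∀ a ∈ S, ∀ b ∈ S, a + b ∈ S) ∧ Sᶜ.Finite

/-- The genus of a numerical semigroup: the number of gaps. -/
noncomputable def genus (S : Set ℕ) : ℕ := Sᶜ.ncard

/-- The weight of a numerical semigroup of genus g: writing the gaps as
ℓ_1 < ⋯ < ℓ_g, it is Σ (ℓ_i − i) = (Σ ℓ_i) − g(g+1)/2. -/
noncomputable def weight (S : Set ℕ) : ℤ :=
  (∑ᶠ ℓ ∈ Sᶜ, (ℓ : ℤ)) - (genus S * (genus S + 1)) / 2

/-- S is (N,γ)-hyperelliptic: the γ smallest positive elements of S are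
n_1 < ⋯ < n_γ, all multiples of N with n_γ = 2γN, and (2γ+1)N ∈ S. -/
def IsNgammaHyperelliptic (N γ : ℕ) (S : Set ℕ) : Prop :=
  IsNumericalSemigroup S ∧
  {s ∈ S | 0 < s ∧ s ≤ 2 * γ * N}.ncard = γ ∧
  (∀ s ∈ S, 0 < s → s ≤ 2 * γ * N → N ∣ s) ∧
  2 * γ * N ∈ S ∧
  (2 * γ + 1) * N ∈ S

/-- u₁ = 2(g−γ)/(N−1) + 1. -/
def u1N (N γ g : ℕ) : ℕ := 2 * (g - γ) / (N - 1) + 1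

/-- The semigroup S_N = N⟨2, 2γ+1⟩ + ⟨u₁, u₁+N⟩, i.e. the submonoid of ℕ
generated by {2N, (2γ+1)N, u₁, u₁+N}. -/
def SN (N γ g : ℕ) : Set ℕ :=
  (AddSubmonoid.closure
    ({2 * N, (2 * γ + 1) * N, u1N N γ g, u1N N γ g + N} : Set ℕ) : AddSubmonoid ℕ)

/-- Elements of the submonoid generated by `2N, (2γ+1)N, u, u+N`, described by residue class
modulo `N`, when `u` exceeds the conductor of `⟨2, 2γ+1⟩`. -/
theorem mem_closure_hyperelliptic_iff {N γ u : ℕ} (hN : 0 < N) (hu : 2 * γ < u) (x : ℕ) :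
    x ∈ AddSubmonoid.closure ({2 * N, (2 * γ + 1) * N, u, u + N} : Set ℕ) ↔
      ∃ j < N, ∃ k, x = j * u + N * k ∧ (j = 0 → Even k ∨ 2 * γ < k) := by
  constructor
  · intro hx
    induction hx using AddSubmonoid.closure_induction with
    | mem x hx =>
      have one_class : ∀ k, ∃ j < N, ∃ l, u + N * k = j * u + N * l ∧
          (j = 0 → Even l ∨ 2 * γ < l) := by
        intro k
        rcases Nat.lt_or_ge 1 N with h | h
        · exact ⟨1, h, k, by ring, by simp⟩
        · obtain rfl : N = 1 := by omega
          exact ⟨0, by simp, u + k, by ring, fun _ => Or.inr (by omega)⟩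
      simp only [Set.mem_insert_iff, Set.mem_singleton_iff] at hx
      rcases hx with rfl | rfl | rfl | rfl
      · exact ⟨0, hN, 2, by ring, fun _ => Or.inl even_two⟩
      · exact ⟨0, hN, 2 * γ + 1, by ring, fun _ => Or.inr (by omega)⟩
      · simpa using one_class 0
      · simpa using one_class 1
    | zero => exact ⟨0, hN, 0, by simp, by simp⟩
    | add x y _ _ ihx ihy =>
      obtain ⟨j, hj, k, rfl, h⟩ := ihx
      obtain ⟨j', hj', k', rfl, h'⟩ := ihy
      by_cases hlt : j + j' < N
      · refine ⟨j + j', hlt, k + k', by ring, fun h0 => ?_⟩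
        rcases h (by omega) with h | h
        · rcases h' (by omega) with h' | h'
          · exact Or.inl (h.add h')
          · exact Or.inr (by omega)
        · exact Or.inr (by omega)
      · obtain ⟨i, hi⟩ := Nat.exists_eq_add_of_le (not_lt.mp hlt)
        refine ⟨i, by omega, k + k' + u, ?_, fun _ => Or.inr (by omega)⟩
        calc j * u + N * k + (j' * u + N * k') = (j + j') * u + N * (k + k') := by ring
          _ = i * u + N * (k + k' + u) := by rw [hi]; ring
  · rintro ⟨j, -, k, rfl, h⟩
    set M := AddSubmonoid.closure ({2 * N, (2 * γ + 1) * N, u, u + N} : Set ℕ)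
    have gen_two : 2 * N ∈ M := AddSubmonoid.subset_closure (by simp)
    have gen_odd : (2 * γ + 1) * N ∈ M := AddSubmonoid.subset_closure (by simp)
    have gen_u : u ∈ M := AddSubmonoid.subset_closure (by simp)
    have gen_uN : u + N ∈ M := AddSubmonoid.subset_closure (by simp)
    have even_mem : ∀ i, i * (2 * N) ∈ M := fun i => by simpa using M.nsmul_mem gen_two i
    have u_mem : ∀ i, i * u ∈ M := fun i => by simpa using M.nsmul_mem gen_u i
    rcases Nat.even_or_odd' k with ⟨i, rfl | rfl⟩
    · have := M.add_mem (u_mem j) (even_mem i)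
      convert this using 1
      ring
    · rcases Nat.eq_zero_or_pos j with rfl | hj
      · have hi : γ ≤ i := by
          rcases h rfl with h | h
          · exact absurd h (by simp)
          · omega
        obtain ⟨l, rfl⟩ := Nat.exists_eq_add_of_le hi
        have := M.add_mem gen_odd (even_mem l)
        convert this using 1
        ring
      · obtain ⟨l, rfl⟩ := Nat.exists_eq_add_of_le' hj
        have := M.add_mem (M.add_mem (u_mem l) gen_uN) (even_mem i)
        convert this using 1
        ring

/-- Multiplication by a unit modulo `N` permutes the residues. -/
theorem mul_mod_injOn_range {N u : ℕ} (h : Nat.Coprime N u) :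
    Set.InjOn (fun j => j * u % N) (Finset.range N : Set ℕ) := by
  intro i hi j hj hij
  simp only [Finset.coe_range, Set.mem_Iio] at hi hj
  have : i ≡ j [MOD N] := Nat.ModEq.cancel_right_of_coprime h hij
  exact this.eq_of_lt_of_lt hi hj

theorem image_mul_mod_range {N u : ℕ} (hN : 0 < N) (h : Nat.Coprime N u) :
    (Finset.range N).image (fun j => j * u % N) = Finset.range N := by
  apply Finset.eq_of_subset_of_card_le
  · intro x hx
    obtain ⟨j, -, rfl⟩ := Finset.mem_image.mp hx
    exact Finset.mem_range.mpr (Nat.mod_lt _ hN)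
  · rw [Finset.card_image_of_injOn (mul_mod_injOn_range h)]

theorem sum_mul_mod_range {N u : ℕ} (hN : 0 < N) (h : Nat.Coprime N u) (f : ℕ → ℤ) :
    ∑ j ∈ Finset.range N, f (j * u % N) = ∑ j ∈ Finset.range N, f j := by
  conv_rhs => rw [← image_mul_mod_range hN h, Finset.sum_image (mul_mod_injOn_range h)]

/-- For the gaps congruent to `j * u` modulo `N`, the possible quotients by `N`. -/
def gapQuotients (N γ u j : ℕ) : Finset ℕ :=
  if j = 0 then (Finset.range γ).image (fun i => 2 * i + 1) else Finset.range (j * u / N)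

/-- The gaps of the semigroup generated by `2N, (2γ+1)N, u, u+N`. -/
def hyperellipticGaps (N γ u : ℕ) : Finset ℕ :=
  ((Finset.range N).sigma (gapQuotients N γ u)).image (fun p => p.1 * u % N + N * p.2)

theorem mem_gapQuotients_zero {N γ u k : ℕ} :
    k ∈ gapQuotients N γ u 0 ↔ ¬ (Even k ∨ 2 * γ < k) := by
  simp only [gapQuotients, if_true, Finset.mem_image, Finset.mem_range, not_or,
    Nat.not_even_iff_odd, not_lt]
  constructor
  · rintro ⟨i, hi, rfl⟩
    exact ⟨odd_two_mul_add_one i, by omega⟩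
  · rintro ⟨⟨i, rfl⟩, h⟩
    exact ⟨i, by omega, rfl⟩

theorem injOn_hyperellipticGaps {N γ u : ℕ} (hN : 0 < N) (h : Nat.Coprime N u) :
    Set.InjOn (fun p : (_ : ℕ) × ℕ => p.1 * u % N + N * p.2)
      ((Finset.range N).sigma (gapQuotients N γ u) : Set ((_ : ℕ) × ℕ)) := by
  rintro ⟨i, k⟩ hp ⟨j, l⟩ hq hpq
  simp only [Finset.mem_coe, Finset.mem_sigma] at hp hq
  simp only at hpq
  have hmod := congrArg (· % N) hpq
  simp only [Nat.add_mul_mod_self_left, Nat.mod_mod] at hmod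
  obtain rfl : i = j := mul_mod_injOn_range h hp.1 hq.1 hmod
  obtain rfl : k = l := Nat.eq_of_mul_eq_mul_left hN (by omega)
  rfl

theorem compl_closure_eq_hyperellipticGaps {N γ u : ℕ} (hN : 0 < N) (h : Nat.Coprime N u)
    (hu : 2 * γ < u) :
    ((AddSubmonoid.closure ({2 * N, (2 * γ + 1) * N, u, u + N} : Set ℕ) :
      AddSubmonoid ℕ) : Set ℕ)ᶜ = (hyperellipticGaps N γ u : Set ℕ) := by
  ext x
  rw [Set.mem_compl_iff, SetLike.mem_coe, mem_closure_hyperelliptic_iff hN hu, Finset.mem_coe,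
    hyperellipticGaps, Finset.mem_image]
  constructor
  · intro hx
    have hr : x % N ∈ (Finset.range N).image (fun j => j * u % N) := by
      rw [image_mul_mod_range hN h]
      exact Finset.mem_range.mpr (Nat.mod_lt _ hN)
    obtain ⟨j, hj, hjx⟩ := Finset.mem_image.mp hr
    have hxd : j * u % N + N * (x / N) = x := by rw [hjx, Nat.mod_add_div]
    refine ⟨⟨j, x / N⟩, Finset.mem_sigma.mpr ⟨hj, ?_⟩, hxd⟩
    by_contra hk
    apply hx
    rcases Nat.eq_zero_or_pos j with rfl | hj0
    · refine ⟨0, hN, x / N, by simpa using hxd.symm, fun _ => ?_⟩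
      exact not_not.mp ((not_congr mem_gapQuotients_zero).mp hk)
    · rw [gapQuotients, if_neg hj0.ne', Finset.mem_range, not_lt] at hk
      obtain ⟨l, hl⟩ := Nat.exists_eq_add_of_le hk
      refine ⟨j, Finset.mem_range.mp hj, l, ?_, by omega⟩
      have := Nat.mod_add_div (j * u) N
      rw [show x / N = j * u / N + l from hl, mul_add] at hxd
      omega
  · rintro ⟨⟨j, k⟩, hp, rfl⟩ ⟨j', hj', k', he, hk'⟩
    obtain ⟨hj, hk⟩ := Finset.mem_sigma.mp hp
    simp only at hj hk he
    have hmod := congrArg (· % N) he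
    simp only [Nat.add_mul_mod_self_left, Nat.mod_mod] at hmod
    obtain rfl : j = j' := mul_mod_injOn_range h hj (by simpa using hj') hmod
    rcases Nat.eq_zero_or_pos j with rfl | hj0
    · obtain rfl : k = k' := Nat.eq_of_mul_eq_mul_left hN (by simpa using he)
      exact mem_gapQuotients_zero.mp hk (hk' rfl)
    · rw [gapQuotients, if_neg hj0.ne', Finset.mem_range] at hk
      have := Nat.mod_add_div (j * u) N
      have hle : N * (k + 1) ≤ N * (j * u / N) := Nat.mul_le_mul_left N hk
      rw [mul_add] at hle
      omega

theorem sum_hyperellipticGaps {N γ u : ℕ} (hN : 0 < N) (h : Nat.Coprime N u) (f : ℕ → ℤ) :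
    ∑ x ∈ hyperellipticGaps N γ u, f x =
      ∑ i ∈ Finset.range γ, f (N * (2 * i + 1)) +
        ∑ j ∈ Finset.range N, ∑ k ∈ Finset.range (j * u / N), f (j * u % N + N * k) := by
  rw [hyperellipticGaps, Finset.sum_image (injOn_hyperellipticGaps hN h), Finset.sum_sigma]
  have key : ∀ j ∈ Finset.range N, ∑ k ∈ gapQuotients N γ u j, f (j * u % N + N * k) =
      (if j = 0 then ∑ i ∈ Finset.range γ, f (N * (2 * i + 1)) else 0) +
        ∑ k ∈ Finset.range (j * u / N), f (j * u % N + N * k) := by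
    intro j _
    by_cases hj : j = 0
    · subst hj
      rw [gapQuotients, if_pos rfl, Finset.sum_image (fun _ _ _ _ hab => by simpa using hab)]
      simp
    · simp [gapQuotients, hj]
  rw [Finset.sum_congr rfl key, Finset.sum_add_distrib, Finset.sum_ite_eq',
    if_pos (Finset.mem_range.mpr hN)]

theorem two_mul_sum_range_id (n : ℕ) : 2 * ∑ j ∈ Finset.range n, (j : ℤ) = n * (n - 1) := by
  induction n with
  | zero => simp
  | succ n ih => rw [Finset.sum_range_succ, mul_add, ih]; push_cast; ring

theorem six_mul_sum_range_sq (n : ℕ) :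
    6 * ∑ j ∈ Finset.range n, (j : ℤ) ^ 2 = n * (n - 1) * (2 * n - 1) := by
  induction n with
  | zero => simp
  | succ n ih => rw [Finset.sum_range_succ, mul_add, ih]; push_cast; ring

theorem sum_range_odd (n : ℕ) : ∑ i ∈ Finset.range n, (2 * (i : ℤ) + 1) = (n : ℤ) ^ 2 := by
  induction n with
  | zero => simp
  | succ n ih => rw [Finset.sum_range_succ, ih]; push_cast; ring

theorem two_mul_sum_arith (N r : ℤ) (q : ℕ) :
    2 * ∑ k ∈ Finset.range q, (r + N * k) = 2 * q * r + N * q * (q - 1) := by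
  induction q with
  | zero => simp
  | succ n ih => rw [Finset.sum_range_succ, mul_add, ih]; push_cast; ring

theorem two_mul_card_hyperellipticGaps {N γ u : ℕ} (hN : 0 < N) (h : Nat.Coprime N u) :
    2 * ((hyperellipticGaps N γ u).card : ℤ) = 2 * γ + (N - 1) * (u - 1) := by
  have hcard : ((hyperellipticGaps N γ u).card : ℤ) =
      γ + ∑ j ∈ Finset.range N, ((j * u / N : ℕ) : ℤ) := by
    simpa using sum_hyperellipticGaps (γ := γ) hN h (fun _ => 1)
  have hN' : (N : ℤ) ≠ 0 := by exact_mod_cast hN.ne'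
  have hq : (N : ℤ) * ∑ j ∈ Finset.range N, ((j * u / N : ℕ) : ℤ) =
      (u - 1) * ∑ j ∈ Finset.range N, (j : ℤ) := by
    rw [sub_mul, one_mul, ← sum_mul_mod_range hN h (fun j => (j : ℤ)), Finset.mul_sum]
    conv_rhs => rw [sum_mul_mod_range hN h (fun j => (j : ℤ)), Finset.mul_sum,
      ← sum_mul_mod_range hN h (fun j => (j : ℤ)), ← Finset.sum_sub_distrib]
    refine Finset.sum_congr rfl fun j _ => ?_
    have : ((j * u % N : ℕ) : ℤ) + N * ((j * u / N : ℕ) : ℤ) = j * u := by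
      exact_mod_cast Nat.mod_add_div (j * u) N
    linarith
  apply mul_left_cancel₀ hN'
  rw [hcard]
  linear_combination 2 * hq + (u - 1 : ℤ) * two_mul_sum_range_id N

theorem twelve_mul_sum_hyperellipticGaps {N γ u : ℕ} (hN : 0 < N) (h : Nat.Coprime N u) :
    12 * ∑ x ∈ hyperellipticGaps N γ u, (x : ℤ) =
      12 * N * γ ^ 2 + (u ^ 2 - 1) * (N - 1) * (2 * N - 1) - 3 * (u - 1) * N * (N - 1) := by
  have hN' : (N : ℤ) ≠ 0 := by exact_mod_cast hN.ne'
  have hodd : ∑ i ∈ Finset.range γ, ((N * (2 * i + 1) : ℕ) : ℤ) = N * γ ^ 2 := by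
    rw [← sum_range_odd, Finset.mul_sum]
    push_cast
    rfl
  have hq : 2 * (N : ℤ) * ∑ j ∈ Finset.range N, ∑ k ∈ Finset.range (j * u / N),
      ((j * u % N + N * k : ℕ) : ℤ) =
      (u ^ 2 * ∑ j ∈ Finset.range N, (j : ℤ) ^ 2 - N * u * ∑ j ∈ Finset.range N, (j : ℤ)) -
        ∑ j ∈ Finset.range N, ((j : ℤ) ^ 2 - N * j) := by
    rw [← sum_mul_mod_range hN h (fun j => (j : ℤ) ^ 2 - N * j), Finset.mul_sum, Finset.mul_sum,
      Finset.mul_sum, ← Finset.sum_sub_distrib, ← Finset.sum_sub_distrib]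
    refine Finset.sum_congr rfl fun j _ => ?_
    have hdiv : ((j * u % N : ℕ) : ℤ) + N * ((j * u / N : ℕ) : ℤ) = j * u := by
      exact_mod_cast Nat.mod_add_div (j * u) N
    have harith := two_mul_sum_arith N ((j * u % N : ℕ) : ℤ) (j * u / N)
    simp only [Nat.cast_add, Nat.cast_mul N]
    generalize ((j * u % N : ℕ) : ℤ) = r at *
    generalize ((j * u / N : ℕ) : ℤ) = q at *
    linear_combination (N : ℤ) * harith + (r + N * q + j * u - N) * hdiv
  rw [Finset.sum_sub_distrib, ← Finset.mul_sum] at hq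
  apply mul_left_cancel₀ hN'
  rw [sum_hyperellipticGaps hN h, hodd]
  linear_combination 6 * hq + (u ^ 2 - 1 : ℤ) * six_mul_sum_range_sq N -
    3 * N * (u - 1 : ℤ) * two_mul_sum_range_id N

/-- the weight of S_N satisfies
6(N−1)W = 2(2N−1)(g−γ)² + (N−1)(N−2)(g−γ) + 6N(N−1)γ² − 3(N−1)g(g+1). -/
theorem stmt15 (N γ : ℕ) (hN : N.Prime) (hN3 : 3 ≤ N) :
    ∃ g₀ : ℕ, ∀ g ≥ g₀,
      (N - 1) / 2 ∣ (g - γ) →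
      (2 * (g - γ) / (N - 1)) % N ≠ N - 1 →
      6 * ((N : ℤ) - 1) * weight (SN N γ g) =
        2 * (2 * (N : ℤ) - 1) * ((g : ℤ) - γ) ^ 2
          + ((N : ℤ) - 1) * ((N : ℤ) - 2) * ((g : ℤ) - γ)
          + 6 * (N : ℤ) * ((N : ℤ) - 1) * (γ : ℤ) ^ 2
          - 3 * ((N : ℤ) - 1) * (g : ℤ) * ((g : ℤ) + 1) := by
  refine ⟨γ + γ * N, fun g hg hdvd hmod => ?_⟩
  obtain ⟨n, rfl⟩ : ∃ n, N = 2 * n + 1 := hN.odd_of_ne_two (by omega)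
  obtain ⟨m, hm⟩ := hdvd
  have hn : 0 < n := by omega
  have hhalf : (2 * n + 1 - 1) / 2 = n := by omega
  rw [hhalf] at hm
  have hquot : 2 * (g - γ) / (2 * n + 1 - 1) = m := by
    rw [hm, Nat.add_sub_cancel, ← mul_assoc, Nat.mul_div_cancel_left _ (by omega)]
  have hg' : g = γ + n * m := by
    have : γ ≤ g := le_trans (Nat.le_add_right _ _) hg
    omega
  have hu : 2 * γ < m + 1 := by
    have h1 : n * (2 * γ) ≤ n * m := by
      have : n * (2 * γ) ≤ γ * (2 * n + 1) := by nlinarith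
      omega
    have := Nat.le_of_mul_le_mul_left h1 hn
    omega
  rw [hquot] at hmod
  have hcop : Nat.Coprime (2 * n + 1) (m + 1) := by
    refine (Nat.Prime.coprime_iff_not_dvd hN).mpr fun ⟨c, hc⟩ => hmod ?_
    obtain ⟨d, rfl⟩ : ∃ d, c = d + 1 := Nat.exists_eq_succ_of_ne_zero (by rintro rfl; simp at hc)
    have : m = 2 * n + (2 * n + 1) * d := by
      rw [mul_add] at hc
      omega
    rw [this, Nat.add_mul_mod_self_left, Nat.mod_eq_of_lt (by omega), Nat.add_sub_cancel]
  have hcompl : (SN (2 * n + 1) γ g)ᶜ = (hyperellipticGaps (2 * n + 1) γ (m + 1) : Set ℕ) := by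
    rw [SN, u1N, hquot]
    exact compl_closure_eq_hyperellipticGaps (by omega) hcop hu
  have hcard := two_mul_card_hyperellipticGaps (γ := γ) (by omega) hcop
  have hsum := twelve_mul_sum_hyperellipticGaps (γ := γ) (by omega) hcop
  have hgenus : (genus (SN (2 * n + 1) γ g) : ℤ) = γ + n * m := by
    rw [genus, hcompl, Set.ncard_coe_finset]
    push_cast at hcard
    linarith
  have hhalfg : 2 * (((γ + n * m : ℤ) * (γ + n * m + 1)) / 2) =
      (γ + n * m : ℤ) * (γ + n * m + 1) :=
    Int.mul_ediv_cancel' (Int.even_mul_succ_self _).two_dvd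
  rw [weight, hgenus, hcompl, finsum_mem_coe_finset, hg']
  push_cast at hsum ⊢
  linear_combination (n : ℤ) * hsum - 6 * (n : ℤ) * hhalfg
end

section
/- Let N ≥ 3 be prime and γ ≥ 1. There exists g₀ (depending on N and γ) such that for every g ≥ g₀ with (N−1)/2 dividing g − γ and (2(g−γ)/(N−1)) mod N ≠ N−1, the semigroup S_N satisfies Buchweitz' criterion: writing G_N = ℕ ∖ S_N, for every integer n ≥ 2 the n-fold sumset n(G_N) = {a_1 + ⋯ + a_n : a_1, …, a_n ∈ G_N} has cardinality at most (2n−1)(g−1). -/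
/-- The n-fold sumset n(A) = {a₁ + ⋯ + a_n : a₁, …, a_n ∈ A}. -/
def nSumset (n : ℕ) (A : Set ℕ) : Set ℕ :=
  {s | ∃ f : Fin n → ℕ, (∀ i, f i ∈ A) ∧ s = ∑ i, f i}

theorem mul_add_mul_mem_SN {N γ g : ℕ} (j k : ℕ) (hj : 1 ≤ j) :
    j * u1N N γ g + N * k ∈ SN N γ g := by
  have h2N : 2 * N ∈ AddSubmonoid.closure
      ({2 * N, (2 * γ + 1) * N, u1N N γ g, u1N N γ g + N} : Set ℕ) :=
    AddSubmonoid.subset_closure (by simp)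
  have hu : u1N N γ g ∈ AddSubmonoid.closure
      ({2 * N, (2 * γ + 1) * N, u1N N γ g, u1N N γ g + N} : Set ℕ) :=
    AddSubmonoid.subset_closure (by simp)
  have huN : u1N N γ g + N ∈ AddSubmonoid.closure
      ({2 * N, (2 * γ + 1) * N, u1N N γ g, u1N N γ g + N} : Set ℕ) :=
    AddSubmonoid.subset_closure (by simp)
  obtain ⟨i, rfl⟩ := Nat.exists_eq_add_of_le hj
  rcases Nat.even_or_odd' k with ⟨l, rfl | rfl⟩
  · rw [show (1 + i) * u1N N γ g + N * (2 * l) = (1 + i) • u1N N γ g + l • (2 * N) by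
      simp only [smul_eq_mul]; ring]
    exact add_mem (nsmul_mem hu (1 + i)) (nsmul_mem h2N l)
  · rw [show (1 + i) * u1N N γ g + N * (2 * l + 1) = i • u1N N γ g + (u1N N γ g + N) + l • (2 * N) by
      simp only [smul_eq_mul]; ring]
    exact add_mem (add_mem (nsmul_mem hu i) huN) (nsmul_mem h2N l)

theorem succ_le_of_mul_notMem_SN {N γ g k : ℕ} (hk : N * k ∉ SN N γ g) : k + 1 ≤ 2 * γ := by
  have h2N : 2 * N ∈ AddSubmonoid.closure
      ({2 * N, (2 * γ + 1) * N, u1N N γ g, u1N N γ g + N} : Set ℕ) :=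
    AddSubmonoid.subset_closure (by simp)
  have hγN : (2 * γ + 1) * N ∈ AddSubmonoid.closure
      ({2 * N, (2 * γ + 1) * N, u1N N γ g, u1N N γ g + N} : Set ℕ) :=
    AddSubmonoid.subset_closure (by simp)
  rcases Nat.even_or_odd' k with ⟨l, rfl | rfl⟩
  · refine absurd ?_ hk
    rw [show N * (2 * l) = l • (2 * N) by
      simp only [smul_eq_mul]; ring]
    exact nsmul_mem h2N l
  · by_contra! h
    obtain ⟨i, rfl⟩ := Nat.exists_eq_add_of_le (show γ ≤ l by omega)
    apply hk
    rw [show N * (2 * (γ + i) + 1) = (2 * γ + 1) * N + i • (2 * N) by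
      simp only [smul_eq_mul]; ring]
    exact add_mem hγN (nsmul_mem h2N i)

/-- Every gap `a` is congruent to `j * u₁` for some `0 ≤ j < N`, and satisfies `a ≤ (2γ - 1)N`
if `j = 0` and `a ≤ j * u₁ - N` otherwise; `e` is the indicator of `j ≠ 0`. -/
theorem gap_bound {N γ g : ℕ} (hN : 2 ≤ N) (hu : (u1N N γ g).Coprime N) {a : ℕ}
    (ha : a ∉ SN N γ g) :
    0 < a ∧ ∃ j e : ℕ, e ≤ 1 ∧ j ≤ e * (N - 1) ∧ (N : ℤ) ∣ j * u1N N γ g - a ∧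
      (a : ℤ) ≤ j * u1N N γ g + (2 * γ - 1) * N - 2 * γ * N * e := by
  have ha0 : 0 < a := by
    rcases Nat.eq_zero_or_pos a with rfl | h
    · exact absurd (AddSubmonoid.zero_mem _) ha
    · exact h
  refine ⟨ha0, ?_⟩
  obtain ⟨b, -, hb⟩ := Nat.exists_mul_mod_eq_one_of_coprime hu (by omega)
  have hcong : (b * a % N) * u1N N γ g ≡ a [MOD N] := by
    have h1 : u1N N γ g * b ≡ 1 [MOD N] := by
      rw [Nat.ModEq, hb, Nat.mod_eq_of_lt (by omega)]
    calc (b * a % N) * u1N N γ g ≡ (b * a) * u1N N γ g [MOD N] :=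
          (Nat.mod_modEq _ _).mul_right _
      _ = (u1N N γ g * b) * a := by ring
      _ ≡ 1 * a [MOD N] := h1.mul_right _
      _ = a := one_mul a
  have hlt : b * a % N < N := Nat.mod_lt _ (by omega)
  generalize b * a % N = j at hcong hlt
  have hdvd : (N : ℤ) ∣ j * u1N N γ g - a := by
    have := (Nat.modEq_iff_dvd.mp hcong.symm)
    push_cast at this
    exact this
  rcases Nat.eq_zero_or_pos j with rfl | hj
  · refine ⟨0, 0, by simp, by simp, hdvd, ?_⟩
    obtain ⟨k, rfl⟩ : N ∣ a := by
      simpa using (Nat.modEq_zero_iff_dvd.mp (by simpa using hcong.symm))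
    have hk : (k : ℤ) + 1 ≤ 2 * γ := by exact_mod_cast succ_le_of_mul_notMem_SN ha
    push_cast
    nlinarith
  · refine ⟨j, 1, le_rfl, by omega, hdvd, ?_⟩
    have hjlt : a < j * u1N N γ g := by
      by_contra! h
      obtain ⟨k, hk⟩ := (Nat.modEq_iff_dvd' h).mp hcong
      apply ha
      have : a = j * u1N N γ g + N * k := by omega
      rw [this]
      exact mul_add_mul_mem_SN j k hj
    have hjlt' : (a : ℤ) < j * u1N N γ g := by exact_mod_cast hjlt
    have := Int.le_of_dvd (by linarith) hdvd
    push_cast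
    linarith

theorem nSumset_gap_bound {N γ g n : ℕ} (hN : 2 ≤ N) (hu : (u1N N γ g).Coprime N) (hn : 1 ≤ n)
    {s : ℕ} (hs : s ∈ nSumset n (SN N γ g)ᶜ) :
    0 < s ∧ ∃ j m : ℕ, m ≤ n ∧ j ≤ m * (N - 1) ∧ (N : ℤ) ∣ j * u1N N γ g - s ∧
      (s : ℤ) ≤ j * u1N N γ g + n * ((2 * γ - 1) * N) - 2 * γ * N * m := by
  obtain ⟨f, hf, rfl⟩ := hs
  choose hpos j e he hj hdvd hle using fun i => gap_bound hN hu (hf i)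
  refine ⟨?_, ∑ i, j i, ∑ i, e i, ?_, ?_, ?_, ?_⟩
  · have : Nonempty (Fin n) := ⟨⟨0, hn⟩⟩
    exact Finset.sum_pos (fun i _ => hpos i) Finset.univ_nonempty
  · simpa using Finset.sum_le_sum fun i (_ : i ∈ Finset.univ) => he i
  · rw [Finset.sum_mul]
    exact Finset.sum_le_sum fun i _ => hj i
  · push_cast
    rw [Finset.sum_mul, ← Finset.sum_sub_distrib]
    exact Finset.dvd_sum fun i _ => hdvd i
  · have := Finset.sum_le_sum fun i (_ : i ∈ Finset.univ) => hle i
    simp only [Finset.sum_sub_distrib, Finset.sum_add_distrib, ← Finset.mul_sum,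
      ← Finset.sum_mul, Finset.sum_const, Finset.card_univ, Fintype.card_fin,
      nsmul_eq_mul] at this
    push_cast
    linear_combination this

/-- A set of positive integers bounded by `M t` in the residue class of `M t` modulo `N`, for a
complete residue system `M 0, …, M (N - 1)`, has at most `∑ ⌈M t / N⌉` elements. -/
theorem two_mul_ncard_le_of_residue_bounds {N : ℕ} (hN : 0 < N) (M : ℕ → ℤ)
    (hM : ∀ t < N, 0 ≤ M t)
    (hinj : ∀ t < N, ∀ t' < N, (N : ℤ) ∣ M t - M t' → t = t') {A : Set ℕ}
    (hA : ∀ s ∈ A, 0 < s ∧ ∃ t < N, (s : ℤ) ≤ M t ∧ (N : ℤ) ∣ M t - s) :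
    2 * (N : ℤ) * A.ncard ≤ 2 * ∑ t ∈ Finset.range N, M t + N * (N - 1) := by
  have hN' : (0 : ℤ) < N := by exact_mod_cast hN
  set C : ℕ → ℤ := fun t => (M t + N - 1) / N with hC
  have hC0 : ∀ t < N, 0 ≤ C t := fun t ht => Int.ediv_nonneg (by linarith [hM t ht]) hN'.le
  have hcover : A ⊆ ((Finset.range N).biUnion fun t =>
      (Finset.range (C t).toNat).image fun k : ℕ => (M t - N * k).toNat : Finset ℕ) := by
    intro s hs
    obtain ⟨hs0, t, ht, hle, k, hk⟩ := hA s hs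
    have hk0 : 0 ≤ k := by
      by_contra! h
      nlinarith
    have hkC : k < C t := by
      rw [Int.lt_iff_add_one_le, hC, Int.le_ediv_iff_mul_le hN']
      have : (1 : ℤ) ≤ s := by exact_mod_cast hs0
      linarith
    lift k to ℕ using hk0
    simp only [Finset.coe_biUnion, Set.mem_iUnion, Finset.coe_image, Set.mem_image,
      Finset.coe_range, Set.mem_Iio]
    exact ⟨t, ht, k, by omega, by omega⟩
  have hcard : (A.ncard : ℤ) ≤ ∑ t ∈ Finset.range N, C t := by
    have h1 := Set.ncard_le_ncard hcover (Finset.finite_toSet _)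
    rw [Set.ncard_coe_finset] at h1
    have h2 : A.ncard ≤ ∑ t ∈ Finset.range N, (C t).toNat :=
      h1.trans <| Finset.card_biUnion_le.trans <| Finset.sum_le_sum fun t _ =>
        Finset.card_image_le.trans (by simp)
    calc (A.ncard : ℤ) ≤ ((∑ t ∈ Finset.range N, (C t).toNat : ℕ) : ℤ) := by exact_mod_cast h2
      _ = ∑ t ∈ Finset.range N, C t := by
        rw [Nat.cast_sum]
        exact Finset.sum_congr rfl fun t ht =>
          Int.toNat_of_nonneg (hC0 t (Finset.mem_range.mp ht))
  set R : ℕ → ℕ := fun t => ((M t + N - 1) % N).toNat with hR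
  have hRcast : ∀ t, (R t : ℤ) = (M t + N - 1) % N := fun t =>
    Int.toNat_of_nonneg (Int.emod_nonneg _ hN'.ne')
  have hRmem : ∀ t ∈ Finset.range N, R t ∈ Finset.range N := by
    intro t _
    have := Int.emod_lt_of_pos (M t + N - 1) hN'
    rw [← hRcast] at this
    simpa using this
  have hRinj : Set.InjOn R (Finset.range N) := by
    intro t ht t' ht' h
    refine hinj t (by simpa using ht) t' (by simpa using ht') ?_
    have h' : (M t + N - 1) % N = (M t' + N - 1) % N := by rw [← hRcast, ← hRcast, h]
    have := Int.ModEq.dvd (show M t' + N - 1 ≡ M t + N - 1 [ZMOD N] from h'.symm)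
    convert this using 1
    ring
  have himage : (Finset.range N).image R = Finset.range N :=
    Finset.eq_of_subset_of_card_le (Finset.image_subset_iff.mpr hRmem)
      (Finset.card_image_of_injOn hRinj).ge
  have hRsum : ∑ t ∈ Finset.range N, R t = ∑ t ∈ Finset.range N, t := by
    conv_rhs => rw [← himage, Finset.sum_image hRinj]
  have hgauss : (∑ t ∈ Finset.range N, (t : ℤ)) * 2 = N * (N - 1) := by
    have := Finset.sum_range_id_mul_two N
    zify [hN] at this
    exact this
  have hdecomp : N * ∑ t ∈ Finset.range N, C t + ∑ t ∈ Finset.range N, (R t : ℤ) =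
      ∑ t ∈ Finset.range N, M t + N * (N - 1) := by
    rw [Finset.mul_sum, ← Finset.sum_add_distrib]
    have : ∀ t ∈ Finset.range N, N * C t + (R t : ℤ) = M t + (N - 1) := by
      intro t _
      rw [hRcast, hC]
      have := Int.mul_ediv_add_emod (M t + N - 1) N
      linarith
    rw [Finset.sum_congr rfl this, Finset.sum_add_distrib, Finset.sum_const, Finset.card_range,
      nsmul_eq_mul]
  have hRsum' : ∑ t ∈ Finset.range N, (R t : ℤ) = ∑ t ∈ Finset.range N, (t : ℤ) := by
    rw [← Nat.cast_sum, hRsum, Nat.cast_sum]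
  nlinarith

/-- The largest possible element of the `n`-fold sumset of the gaps in the residue class of
`(n * (N - 1) - t) * u`. -/
def residueMax (N γ u n t : ℕ) : ℤ :=
  (n * ((N : ℤ) - 1) - t) * u - n * N + if t = N - 1 then 2 * (γ : ℤ) * N else 0

theorem exists_le_residueMax {N γ u n j m s : ℕ} (hN : 3 ≤ N) (hu : 2 * γ * N ≤ u)
    (hm : m ≤ n) (hj : j ≤ m * (N - 1)) (hdvd : (N : ℤ) ∣ j * u - s)
    (hs : (s : ℤ) ≤ j * u + n * ((2 * γ - 1) * N) - 2 * γ * N * m) :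
    ∃ t < N, (s : ℤ) ≤ residueMax N γ u n t ∧ (N : ℤ) ∣ residueMax N γ u n t - s := by
  obtain ⟨p, rfl⟩ : ∃ p, N = p + 1 := ⟨N - 1, by omega⟩
  obtain ⟨d, rfl⟩ := Nat.exists_eq_add_of_le hm
  simp only [Nat.add_sub_cancel] at hj
  obtain ⟨r, hr⟩ := Nat.exists_eq_add_of_le hj
  set T := d * p + r with hT
  have hdiv := Nat.div_add_mod T (p + 1)
  have hlt : T % (p + 1) < p + 1 := Nat.mod_lt _ (by omega)
  generalize T / (p + 1) = q at hdiv
  generalize T % (p + 1) = t at hdiv hlt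
  refine ⟨t, hlt, ?_, ?_⟩
  · have hjt : (j : ℤ) = (m + d) * p - t - q * (p + 1) := by
      zify at hdiv hr hT
      linarith
    have hkey : 2 * (γ : ℤ) * (p + 1) * d ≤
        q * (p + 1) * u + if t = p then 2 * γ * (p + 1 : ℤ) else 0 := by
      rcases Nat.eq_zero_or_pos q with rfl | hq
      · split_ifs with htp
        · have hd : d ≤ 1 := by
            by_contra! h
            nlinarith
          zify at hd
          have : 0 ≤ 2 * (γ : ℤ) * (p + 1) := by positivity
          nlinarith
        · have hd : d = 0 := by
            by_contra h
            have : 1 ≤ d := by omega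
            have : t < p := by omega
            nlinarith
          simp [hd]
      · have hd : d ≤ q * (p + 1) := by nlinarith
        have h1 : 2 * γ * (p + 1) * d ≤ q * (p + 1) * u := by
          calc 2 * γ * (p + 1) * d ≤ u * (q * (p + 1)) := Nat.mul_le_mul hu hd
            _ = q * (p + 1) * u := by ring
        zify at h1
        split_ifs
        · have : 0 ≤ 2 * (γ : ℤ) * (p + 1) := by positivity
          linarith
        · linarith
    simp only [residueMax, Nat.add_sub_cancel]
    push_cast at hs ⊢
    rw [hjt] at hs
    split_ifs at hkey ⊢ <;> nlinarith
  · have hjt : ((m : ℤ) + d) * p - t = j + q * (p + 1) := by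
      zify at hdiv hr hT
      linarith
    simp only [residueMax, Nat.add_sub_cancel]
    push_cast at hdvd ⊢
    rw [add_sub_cancel_right, hjt]
    obtain ⟨w, hw⟩ := hdvd
    split_ifs
    · exact ⟨w + q * u - (m + d) + 2 * γ, by linear_combination hw⟩
    · exact ⟨w + q * u - (m + d), by linear_combination hw⟩

theorem residueMax_nonneg {N γ u n t : ℕ} (hN : 3 ≤ N) (hn : 2 ≤ n) (hu : N ≤ u) (ht : t < N) :
    0 ≤ residueMax N γ u n t := by
  have h1 : (n : ℤ) * N ≤ (n * ((N : ℤ) - 1) - t) * u := by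
    zify at hN hn hu ht
    have : (n : ℤ) ≤ n * ((N : ℤ) - 1) - t := by nlinarith
    exact mul_le_mul this hu (by positivity) (by linarith)
  have h2 : 0 ≤ if t = N - 1 then 2 * (γ : ℤ) * N else 0 := by
    split_ifs <;> positivity
  rw [residueMax]
  linarith

theorem residueMax_injective_mod {N γ u n t t' : ℕ} (hu : u.Coprime N) (ht : t < N)
    (ht' : t' < N) (h : (N : ℤ) ∣ residueMax N γ u n t - residueMax N γ u n t') : t = t' := by
  have h1 : (N : ℤ) ∣ ((t' : ℤ) - t) * u := by
    obtain ⟨w, hw⟩ := h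
    simp only [residueMax] at hw
    split_ifs at hw
    · exact ⟨w, by linear_combination hw⟩
    · exact ⟨w - 2 * γ, by linear_combination hw⟩
    · exact ⟨w + 2 * γ, by linear_combination hw⟩
    · exact ⟨w, by linear_combination hw⟩
  have h2 : (N : ℤ) ∣ (t' : ℤ) - t :=
    IsCoprime.dvd_of_dvd_mul_right (Nat.isCoprime_iff_coprime.mpr hu).symm h1
  have h3 := Int.eq_zero_of_abs_lt_dvd h2 (by rw [abs_lt]; constructor <;> omega)
  omega

theorem two_mul_sum_residueMax {N γ u n : ℕ} (hN : 1 ≤ N) :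
    2 * ∑ t ∈ Finset.range N, residueMax N γ u n t =
      N * ((2 * n - 1) * (N - 1) * u - 2 * n * N + 4 * γ) := by
  have hgauss : (∑ t ∈ Finset.range N, (t : ℤ)) * 2 = N * (N - 1) := by
    have := Finset.sum_range_id_mul_two N
    zify [hN] at this
    exact this
  have hite : ∑ t ∈ Finset.range N, (if t = N - 1 then 2 * (γ : ℤ) * N else 0) = 2 * γ * N := by
    rw [Finset.sum_ite_eq', if_pos (Finset.mem_range.mpr (by omega))]
  simp only [residueMax, Finset.sum_add_distrib, Finset.sum_sub_distrib, hite, ← Finset.sum_mul,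
    Finset.sum_const, Finset.card_range, nsmul_eq_mul]
  linear_combination -(u : ℤ) * hgauss

/-- S_N satisfies Buchweitz' criterion: #n(G_N) ≤ (2n−1)(g−1)
for every n ≥ 2. -/
theorem stmt17 (N γ : ℕ) (hN : N.Prime) (hN3 : 3 ≤ N) (hγ : 1 ≤ γ) :
    ∃ g₀ : ℕ, ∀ g ≥ g₀,
      (N - 1) / 2 ∣ (g - γ) →
      (2 * (g - γ) / (N - 1)) % N ≠ N - 1 →
      ∀ n : ℕ, 2 ≤ n →
        ((nSumset n ((SN N γ g)ᶜ)).ncard : ℤ) ≤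
          (2 * (n : ℤ) - 1) * ((g : ℤ) - 1) := by
  obtain ⟨h, hh⟩ : ∃ h, N = 2 * h + 1 := (hN.odd_of_ne_two (by omega))
  have hh1 : 1 ≤ h := by omega
  refine ⟨γ + 2 * γ * N * h, fun g hg hdvd hmod n hn => ?_⟩
  have hhalf : (N - 1) / 2 = h := by omega
  rw [hhalf] at hdvd
  obtain ⟨c, hc⟩ := hdvd
  have hgc : g = γ + h * c := by
    have : γ ≤ g := (Nat.le_add_right _ _).trans hg
    omega
  have hquot : 2 * (g - γ) / (N - 1) = c := by
    rw [hc, show N - 1 = 2 * h by omega, ← mul_assoc]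
    exact Nat.mul_div_cancel_left _ (by omega)
  have hu : u1N N γ g = c + 1 := by rw [u1N, hquot]
  rw [hquot] at hmod
  have hcop : (c + 1).Coprime N := by
    refine (hN.coprime_iff_not_dvd.mpr fun hd => hmod ?_).symm
    obtain ⟨k, hk⟩ := hd
    obtain ⟨l, rfl⟩ : ∃ l, k = l + 1 := ⟨k - 1, by
      have : k ≠ 0 := by rintro rfl; simp at hk
      omega⟩
    have : c = (N - 1) + N * l := by
      rw [mul_add] at hk
      omega
    rw [this, Nat.add_mul_mod_self_left, Nat.mod_eq_of_lt (by omega)]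
  have hcbig : 2 * γ * N ≤ c := by
    have : h * (2 * γ * N) ≤ h * c := by linarith [mul_comm h (2 * γ * N)]
    exact Nat.le_of_mul_le_mul_left this (by omega)
  have hNc : N ≤ c + 1 := by nlinarith
  have hbound := two_mul_ncard_le_of_residue_bounds (by omega) (residueMax N γ (c + 1) n)
    (fun t ht => residueMax_nonneg hN3 hn hNc ht)
    (fun t ht t' ht' => residueMax_injective_mod hcop ht ht')
    (A := nSumset n (SN N γ g)ᶜ) (fun s hs => by
      obtain ⟨hs0, j, m, hm, hj, hd, hle⟩ :=
        nSumset_gap_bound (by omega) (hu ▸ hcop) (by omega) hs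
      rw [hu] at hd hle
      exact ⟨hs0, exists_le_residueMax hN3 (by omega) hm hj hd hle⟩)
  rw [two_mul_sum_residueMax (by omega)] at hbound
  generalize (nSumset n (SN N γ g)ᶜ).ncard = K at hbound ⊢
  have hK : 2 * (K : ℤ) ≤
      (2 * n - 1) * (N - 1) * (c + 1 : ℕ) - 2 * n * N + 4 * γ + (N - 1) := by
    refine le_of_mul_le_mul_left ?_ (show (0 : ℤ) < N by exact_mod_cast hN.pos)
    linarith
  have hslack : (0 : ℤ) ≤ (2 * n - 3) * (γ - 1) + (n - 2) := by
    zify at hn hγ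
    have : (0 : ℤ) ≤ (2 * n - 3) * (γ - 1) := mul_nonneg (by linarith) (by linarith)
    linarith
  rw [hh] at hK
  rw [hgc]
  push_cast at hK ⊢
  linarith
end
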